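/- arXiv:1702.02400 — 3 statements merged into one kernel-verified Lean document; each statement's English description precedes it below -/
import Mathlib

section
/- Let n ≥ 1, let U ⊆ ℝⁿ be an open set with ℝ^{>0}·U ⊆ U, let k > 1 be real, and let h : U → ℝ be smooth, positive, and positively homogeneous of degree k. Set g_U(x) = −(D²h)ₓ and ǧ(x)(u, v) = g_U(x)(u, v) − g_U(x)(x, u)·g_U(x)(x, v)/g_U(x)(x, x), and assume that for every x ∈ U the restriction of g_U(x) to ker((Dh)ₓ) is positive definite. Then for every x ∈ U the symmetric bilinear form g'(x) := −(D²(log h))ₓ satisfies g'(x) = (1/h(x))·ǧ(x) + (1/(k·h(x)²))·(Dh)ₓ ⊗ (Dh)ₓ, and g'(x) is positive definite. -/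
noncomputable section

/-- The second derivative of `f` at `x`, as a bilinear form: `(D²f)ₓ(u, v)`. -/
def D2 {n : ℕ} (f : (Fin n → ℝ) → ℝ) (x u v : Fin n → ℝ) : ℝ :=
  fderiv ℝ (fderiv ℝ f) x u v

/-- The symmetric bilinear form `g_U(x) = −(D²h)ₓ`. -/
def gU {n : ℕ} (h : (Fin n → ℝ) → ℝ) (x u v : Fin n → ℝ) : ℝ := -D2 h x u v

/-- The symmetric bilinear form
`ǧ(x)(u, v) = g_U(x)(u, v) − g_U(x)(x, u)·g_U(x)(x, v)/g_U(x)(x, x)`. -/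
def gcheck {n : ℕ} (h : (Fin n → ℝ) → ℝ) (x u v : Fin n → ℝ) : ℝ :=
  gU h x u v - gU h x x u * gU h x x v / gU h x x x

/-- The symmetric bilinear form `g'(x) = −(D²(log h))ₓ`. -/
def gprime {n : ℕ} (h : (Fin n → ℝ) → ℝ) (x u v : Fin n → ℝ) : ℝ :=
  -D2 (fun y => Real.log (h y)) x u v

section Homogeneous

variable {E : Type*} [NormedAddCommGroup E] [NormedSpace ℝ E]

/-- Euler's identity for a positively homogeneous function. -/
theorem fderiv_apply_self_of_homogeneous {h : E → ℝ} {k : ℝ} {x : E}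
    (hd : DifferentiableAt ℝ h x) (hhom : ∀ l : ℝ, 0 < l → h (l • x) = l ^ k * h x) :
    fderiv ℝ h x x = k * h x := by
  have hline : HasDerivAt (fun t : ℝ => t • x) x 1 := by
    simpa using (hasDerivAt_id (1 : ℝ)).smul_const x
  have hchain : HasDerivAt (fun t : ℝ => h (t • x)) (fderiv ℝ h x x) 1 := by
    have hd' : HasFDerivAt h (fderiv ℝ h x) ((1 : ℝ) • x) := by
      simpa using hd.hasFDerivAt
    exact hd'.comp_hasDerivAt (1 : ℝ) hline
  have hpow : HasDerivAt (fun t : ℝ => t ^ k * h x) (k * h x) 1 := by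
    simpa using (Real.hasDerivAt_rpow_const (x := 1) (p := k) (Or.inl one_ne_zero)).mul_const (h x)
  refine hchain.unique (hpow.congr_of_eventuallyEq ?_)
  filter_upwards [lt_mem_nhds (zero_lt_one' ℝ)] with t ht using hhom t ht

/-- The derivative of Euler's identity. -/
theorem fderiv_fderiv_apply_self_of_euler {h : E → ℝ} {k : ℝ} {x : E}
    (hd : DifferentiableAt ℝ h x) (hd2 : DifferentiableAt ℝ (fderiv ℝ h) x)
    (heuler : ∀ᶠ y in nhds x, fderiv ℝ h y y = k * h y) (u : E) :
    fderiv ℝ (fderiv ℝ h) x u x = (k - 1) * fderiv ℝ h x u := by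
  have hleft := hd2.hasFDerivAt.clm_apply (hasFDerivAt_id x)
  have hright := (hd.hasFDerivAt.const_mul k).congr_of_eventuallyEq heuler
  have hu := congrArg (fun L : E →L[ℝ] ℝ => L u) (hleft.unique hright)
  simp at hu
  linarith

/-- The Hessian of `log ∘ h` at a point where `h` does not vanish. -/
theorem fderiv_fderiv_log_apply {h : E → ℝ} {x : E}
    (hd : ∀ᶠ y in nhds x, DifferentiableAt ℝ h y)
    (hd2 : DifferentiableAt ℝ (fderiv ℝ h) x) (hne : h x ≠ 0) (u v : E) :
    fderiv ℝ (fderiv ℝ fun y => Real.log (h y)) x u v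
      = fderiv ℝ (fderiv ℝ h) x u v / h x - fderiv ℝ h x u * fderiv ℝ h x v / h x ^ 2 := by
  have hdx := hd.self_of_nhds
  have hlog : (fderiv ℝ fun y => Real.log (h y)) =ᶠ[nhds x] fun y => (h y)⁻¹ • fderiv ℝ h y := by
    filter_upwards [hd, hdx.continuousAt.eventually_ne hne] with y hy hy0
    exact (hy.hasFDerivAt.log hy0).fderiv
  have hinv : HasFDerivAt (fun y => (h y)⁻¹) (-(h x ^ 2)⁻¹ • fderiv ℝ h x) x :=
    (hasDerivAt_inv hne).comp_hasFDerivAt x hdx.hasFDerivAt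
  rw [hlog.fderiv_eq, (hinv.fun_smul hd2.hasFDerivAt).fderiv]
  simp
  field_simp
  ring

end Homogeneous

/-- Let `h` be smooth, positive and positively homogeneous of degree `k > 1` on an
open cone `U ⊆ ℝⁿ`, with `g_U(x) = −(D²h)ₓ` positive definite on `ker (Dh)ₓ` for all
`x ∈ U`.  Then `g'(x) = −(D²(log h))ₓ` satisfies
`g'(x) = (1/h(x))·ǧ(x) + (1/(k·h(x)²))·(Dh)ₓ ⊗ (Dh)ₓ` and is positive definite. -/
theorem stmt13 {n : ℕ} (hn : 1 ≤ n)
    (U : Set (Fin n → ℝ)) (hU : IsOpen U)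
    (hcone : ∀ l : ℝ, 0 < l → ∀ x ∈ U, l • x ∈ U)
    (k : ℝ) (hk : 1 < k)
    (h : (Fin n → ℝ) → ℝ) (hsm : ContDiffOn ℝ (⊤ : ℕ∞) h U)
    (hpos : ∀ x ∈ U, 0 < h x)
    (hhom : ∀ l : ℝ, 0 < l → ∀ x ∈ U, h (l • x) = l ^ k * h x)
    (hker : ∀ x ∈ U, ∀ v : Fin n → ℝ, fderiv ℝ h x v = 0 → v ≠ 0 → 0 < gU h x v v) :
    ∀ x ∈ U,
      (∀ u v : Fin n → ℝ,
        gprime h x u v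
          = (1 / h x) * gcheck h x u v
            + (1 / (k * (h x) ^ 2)) * (fderiv ℝ h x u * fderiv ℝ h x v)) ∧
      (∀ v : Fin n → ℝ, v ≠ 0 → 0 < gprime h x v v) := by
  intro x hx
  have hcd : ∀ y ∈ U, ContDiffAt ℝ (⊤ : ℕ∞) h y := fun y hy => hsm.contDiffAt (hU.mem_nhds hy)
  have hd : ∀ y ∈ U, DifferentiableAt ℝ h y := fun y hy =>
    (hcd y hy).differentiableAt (by simp)
  have hd2 : DifferentiableAt ℝ (fderiv ℝ h) x :=
    ((hcd x hx).fderiv_right (m := 1) (by norm_cast)).differentiableAt one_ne_zero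
  have heuler : ∀ y ∈ U, fderiv ℝ h y y = k * h y := fun y hy =>
    fderiv_apply_self_of_homogeneous (hd y hy) fun l hl => hhom l hl y hy
  have hsymm : IsSymmSndFDerivAt ℝ h x := (hcd x hx).isSymmSndFDerivAt (by
    rw [minSmoothness_of_isRCLikeNormedField]
    exact WithTop.coe_le_coe.2 le_top)
  have hright : ∀ u, fderiv ℝ (fderiv ℝ h) x u x = (k - 1) * fderiv ℝ h x u :=
    fderiv_fderiv_apply_self_of_euler (hd x hx) hd2
      (Filter.eventually_of_mem (hU.mem_nhds hx) heuler)
  have hleft : ∀ u, fderiv ℝ (fderiv ℝ h) x x u = (k - 1) * fderiv ℝ h x u := fun u => by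
    rw [hsymm.eq x u, hright]
  have hprime : ∀ u v, gprime h x u v
      = fderiv ℝ h x u * fderiv ℝ h x v / h x ^ 2 - fderiv ℝ (fderiv ℝ h) x u v / h x :=
    fun u v => by
      rw [gprime, D2, fderiv_fderiv_log_apply (Filter.eventually_of_mem (hU.mem_nhds hx) hd) hd2
        (hpos x hx).ne']
      ring
  have hx0 : 0 < h x := hpos x hx
  have hk1 : k - 1 ≠ 0 := by linarith
  have hk0 : 0 < k := by linarith
  refine ⟨fun u v => ?_, fun v hv => ?_⟩
  · rw [hprime, gcheck, gU, gU, gU, gU, D2, D2, D2, D2, hleft, hleft, hleft, heuler x hx]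
    field_simp
    ring
  · obtain ⟨a, ha⟩ : ∃ a, a = fderiv ℝ h x v / (k * h x) := ⟨_, rfl⟩
    obtain ⟨w, hw⟩ : ∃ w, w = v - a • x := ⟨_, rfl⟩
    have hDv : fderiv ℝ h x v = a * (k * h x) := by
      rw [ha]; field_simp
    have hDw : fderiv ℝ h x w = 0 := by
      rw [hw, map_sub, map_smul, heuler x hx, hDv, smul_eq_mul, sub_self]
    have hsplit : gprime h x v v = (k * a ^ 2 * h x + gU h x w w) / h x := by
      have hvw : v = a • x + w := by rw [hw]; abel
      rw [hprime, hDv, hvw, gU, D2]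
      simp only [map_add, map_smul, add_apply, smul_apply, smul_eq_mul, hleft, hright, hDw,
        heuler x hx]
      field_simp
      ring
    rw [hsplit]
    refine div_pos ?_ hx0
    by_cases hw0 : w = 0
    · have ha0 : a ≠ 0 := by
        rintro rfl
        apply hv
        rw [zero_smul, sub_zero] at hw
        rw [← hw, hw0]
      have hww : gU h x w w = 0 := by simp [hw0, gU, D2]
      rw [hww]
      positivity
    · have hww := hker x hx w hDw hw0
      positivity
end
end

section
/- Let n ≥ 1, let U ⊆ ℝⁿ be an open set with ℝ^{>0}·U ⊆ U, let k > 1 be real, let h : U → ℝ be smooth, positive, and positively homogeneous of degree k, and let c ∈ ℝ; define U_c = {x ∈ U : h(x) + c > 0} if c ≤ 0 and U_c = {x ∈ U : h(x) − c(k−1) > 0} if c > 0. For λ > 0 let φ_λ : ℝⁿ → ℝⁿ be scalar multiplication by λ. Then φ_λ maps U_c bijectively onto U_{λᵏc}, and for all x ∈ U_c and u, v ∈ ℝⁿ one has λ²·(D²(log(h + λᵏc)))_{λx}(u, v) = (D²(log(h + c)))ₓ(u, v); consequently φ_λ*(g'_{λᵏc}) = g'_c, where g'_c(x) = −(D²(log(h+c)))ₓ.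 -/
noncomputable section

/-- The symmetric bilinear form `g'_c(x) = −(D²(log(h+c)))ₓ`. -/
def gprimec {n : ℕ} (h : (Fin n → ℝ) → ℝ) (c : ℝ) (x u v : Fin n → ℝ) : ℝ :=
  -D2 (fun y => Real.log (h y + c)) x u v

/-- The domain `U_c`: `{x ∈ U : h(x) + c > 0}` for `c ≤ 0`, and
`{x ∈ U : h(x) − c(k−1) > 0}` for `c > 0`. -/
def Uc {n : ℕ} (h : (Fin n → ℝ) → ℝ) (U : Set (Fin n → ℝ)) (k c : ℝ) :
    Set (Fin n → ℝ) :=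
  if c ≤ 0 then {x ∈ U | 0 < h x + c} else {x ∈ U | 0 < h x - c * (k - 1)}

open scoped Topology

/-- If `f` agrees near `x` with `y ↦ a + g (l • y)`, then
`(D²f)ₓ = l² · (D²g)_{l x}`. -/
theorem D2_eq_of_eventuallyEq_comp_smul {n : ℕ} {f g : (Fin n → ℝ) → ℝ} {a l : ℝ}
    {x : Fin n → ℝ} (hfg : ∀ᶠ y in 𝓝 x, f y = a + g (l • y)) (u v : Fin n → ℝ) :
    D2 f x u v = l ^ 2 * D2 g (l • x) u v := by
  have hfderiv : fderiv ℝ f =ᶠ[𝓝 x] l • fun y => fderiv ℝ g (l • y) := by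
    have hev : f =ᶠ[𝓝 x] fun y => a + g (l • y) := hfg
    refine hev.fderiv.trans (Filter.Eventually.of_forall fun y => ?_)
    simp only [fderiv_const_add, fderiv_comp_smul, Pi.smul_apply]
  rw [D2, D2, hfderiv.fderiv_eq,
    fderiv_const_smul_field (𝕜 := ℝ) (f := fun y => fderiv ℝ g (l • y)) l,
    Pi.smul_apply, fderiv_comp_smul]
  simp only [smul_apply, smul_eq_mul]
  ring

theorem mem_Uc_smul {n : ℕ} {U : Set (Fin n → ℝ)} {k : ℝ} {h : (Fin n → ℝ) → ℝ}
    (hcone : ∀ l : ℝ, 0 < l → ∀ x ∈ U, l • x ∈ U)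
    (hhom : ∀ l : ℝ, 0 < l → ∀ x ∈ U, h (l • x) = l ^ k * h x)
    {c l : ℝ} (hl : 0 < l) {x : Fin n → ℝ} (hx : x ∈ Uc h U k c) :
    l • x ∈ Uc h U k (l ^ k * c) := by
  have hlk : 0 < l ^ k := Real.rpow_pos_of_pos hl k
  unfold Uc at hx ⊢
  by_cases hc : c ≤ 0
  · rw [if_pos hc] at hx
    rw [if_pos (mul_nonpos_of_nonneg_of_nonpos hlk.le hc)]
    refine ⟨hcone l hl x hx.1, ?_⟩
    rw [hhom l hl x hx.1, ← mul_add]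
    exact mul_pos hlk hx.2
  · rw [if_neg hc] at hx
    rw [if_neg (mul_pos hlk (not_le.mp hc)).not_ge]
    refine ⟨hcone l hl x hx.1, ?_⟩
    rw [hhom l hl x hx.1, mul_assoc, ← mul_sub]
    exact mul_pos hlk hx.2

theorem mem_and_add_pos_of_mem_Uc {n : ℕ} {U : Set (Fin n → ℝ)} {k : ℝ}
    {h : (Fin n → ℝ) → ℝ} (hpos : ∀ x ∈ U, 0 < h x) {c : ℝ} {x : Fin n → ℝ}
    (hx : x ∈ Uc h U k c) : x ∈ U ∧ 0 < h x + c := by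
  unfold Uc at hx
  split_ifs at hx with hc
  · exact hx
  · exact ⟨hx.1, add_pos (hpos x hx.1) (not_le.mp hc)⟩

/-- Let `h` be smooth, positive and positively homogeneous of degree `k > 1` on an
open cone `U ⊆ ℝⁿ`, `c ∈ ℝ`, `λ > 0`.  Then scalar multiplication `φ_λ` maps `U_c`
bijectively onto `U_{λᵏc}`, and
`λ²·(D²(log(h + λᵏc)))_{λx}(u, v) = (D²(log(h + c)))ₓ(u, v)` for `x ∈ U_c`;
consequently `φ_λ*(g'_{λᵏc}) = g'_c`. -/
theorem stmt15 {n : ℕ} (hn : 1 ≤ n)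
    (U : Set (Fin n → ℝ)) (hU : IsOpen U)
    (hcone : ∀ l : ℝ, 0 < l → ∀ x ∈ U, l • x ∈ U)
    (k : ℝ) (hk : 1 < k)
    (h : (Fin n → ℝ) → ℝ) (hsm : ContDiffOn ℝ (⊤ : ℕ∞) h U)
    (hpos : ∀ x ∈ U, 0 < h x)
    (hhom : ∀ l : ℝ, 0 < l → ∀ x ∈ U, h (l • x) = l ^ k * h x)
    (c : ℝ) (l : ℝ) (hl : 0 < l) :
    Set.BijOn (fun x => l • x) (Uc h U k c) (Uc h U k (l ^ k * c)) ∧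
    (∀ x ∈ Uc h U k c, ∀ u v : Fin n → ℝ,
      l ^ (2 : ℕ) * D2 (fun y => Real.log (h y + l ^ k * c)) (l • x) u v
        = D2 (fun y => Real.log (h y + c)) x u v) ∧
    (∀ x ∈ Uc h U k c, ∀ u v : Fin n → ℝ,
      gprimec h (l ^ k * c) (l • x) (l • u) (l • v) = gprimec h c x u v) := by
  have hlk : 0 < l ^ k := Real.rpow_pos_of_pos hl k
  have hD2 : ∀ x ∈ Uc h U k c, ∀ u v : Fin n → ℝ,
      l ^ (2 : ℕ) * D2 (fun y => Real.log (h y + l ^ k * c)) (l • x) u v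
        = D2 (fun y => Real.log (h y + c)) x u v := by
    intro x hx u v
    obtain ⟨hxU, hxc⟩ := mem_and_add_pos_of_mem_Uc hpos hx
    have hcont : ContinuousAt (fun y => h y + c) x :=
      (hsm.continuousOn.continuousAt (hU.mem_nhds hxU)).add continuousAt_const
    refine (D2_eq_of_eventuallyEq_comp_smul (a := -Real.log (l ^ k)) ?_ u v).symm
    filter_upwards [hU.mem_nhds hxU, hcont.eventually (lt_mem_nhds hxc)] with y hyU hyc
    rw [hhom l hl y hyU, ← mul_add, Real.log_mul hlk.ne' hyc.ne', neg_add_cancel_left]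
  refine ⟨⟨fun x hx => mem_Uc_smul hcone hhom hl hx,
    (smul_right_injective _ hl.ne').injOn, fun y hy => ?_⟩, hD2, fun x hx u v => ?_⟩
  · refine ⟨l⁻¹ • y, ?_, smul_inv_smul₀ hl.ne' y⟩
    have hmem := mem_Uc_smul hcone hhom (inv_pos.mpr hl) hy
    rwa [Real.inv_rpow hl.le, inv_mul_cancel_left₀ hlk.ne'] at hmem
  · rw [gprimec, gprimec, ← hD2 x hx u v]
    simp only [D2, map_smul, smul_apply, smul_eq_mul]
    ring
end
end

section
/- Let n ≥ 1, let U ⊆ ℝⁿ be an open set with ℝ^{>0}·U ⊆ U, let k > 1 be real, let h : U → ℝ be smooth, positive, and positively homogeneous of degree k, and assume that for every x ∈ U the restriction of −(D²h)ₓ to ker((Dh)ₓ) is positive definite. Set g'(x) = −(D²(log h))ₓ and, for c < 0, g'_c(x) = −(D²(log(h+c)))ₓ on U_c = {x ∈ U : h(x) + c > 0}. Assume g' is complete on U in the sense that for every T ∈ (0, ∞] and every continuously differentiable curve γ : [0, T) → U whose image is not contained in any compact subset of U, the length ∫₀ᵀ √(g'(γ(t))(γ'(t), γ'(t))) dt is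 infinite. Then for every c < 0, g'_c is complete on U_c in the same sense: every continuously differentiable curve γ : [0, T) → U_c whose image is not contained in any compact subset of U_c has infinite length ∫₀ᵀ √(g'_c(γ(t))(γ'(t), γ'(t))) dt = ∞. -/
noncomputable section

open MeasureTheory
open scoped ENNReal

/-- The parameter interval `[0, T)` for `T ∈ (0, ∞]`, as a subset of `ℝ`. -/
def Ival (T : ℝ≥0∞) : Set ℝ := {t : ℝ | 0 ≤ t ∧ ENNReal.ofReal t < T}

/-- Completeness of a field `g` of quadratic forms on a set `V ⊆ ℝⁿ`: every
continuously differentiable curve `γ : [0, T) → V` (with `T ∈ (0, ∞]`) whose image is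
not contained in any compact subset of `V` has infinite length
`∫₀ᵀ √(g(γ(t))(γ'(t), γ'(t))) dt = ∞`. -/
def IsCompleteMetricOn {n : ℕ} (g : (Fin n → ℝ) → (Fin n → ℝ) → (Fin n → ℝ) → ℝ)
    (V : Set (Fin n → ℝ)) : Prop :=
  ∀ T : ℝ≥0∞, 0 < T → ∀ γ : ℝ → (Fin n → ℝ),
    ContDiffOn ℝ 1 γ (Ival T) →
    Set.MapsTo γ (Ival T) V →
    (¬ ∃ K : Set (Fin n → ℝ), IsCompact K ∧ K ⊆ V ∧ γ '' (Ival T) ⊆ K) →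
    ∫⁻ t in Ival T, ENNReal.ofReal (Real.sqrt (g (γ t) (deriv γ t) (deriv γ t))) = ⊤

/-- The second derivative of `log (h + c)` on the diagonal. -/
lemma gprimec_apply_self {n : ℕ} {h : (Fin n → ℝ) → ℝ} {c : ℝ} {x : Fin n → ℝ}
    (hx : ContDiffAt ℝ 2 h x) (hpos : 0 < h x + c) (v : Fin n → ℝ) :
    gprimec h c x v v =
      -D2 h x v v / (h x + c) + (fderiv ℝ h x v) ^ 2 / (h x + c) ^ 2 := by
  have hne := hpos.ne'
  have hfd : DifferentiableAt ℝ (fderiv ℝ h) x :=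
    (hx.fderiv_right (m := 1) (by norm_num)).differentiableAt (by norm_num)
  have hd : DifferentiableAt ℝ h x := hx.differentiableAt (by norm_num)
  have hev : fderiv ℝ (fun y => Real.log (h y + c)) =ᶠ[nhds x]
      fun y => (h y + c)⁻¹ • fderiv ℝ h y := by
    have hpos_ev : ∀ᶠ y in nhds x, 0 < h y + c :=
      (hx.continuousAt.add continuousAt_const).eventually (lt_mem_nhds hpos)
    filter_upwards [hpos_ev, hx.eventually (by simp)] with y hy hcy
    have hdy := (hcy.differentiableAt (by norm_num)).hasFDerivAt
    exact ((hdy.add_const c).log hy.ne').fderiv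
  have hinv : HasFDerivAt (fun y => (h y + c)⁻¹) (-((h x + c) ^ 2)⁻¹ • fderiv ℝ h x) x :=
    (hasDerivAt_inv hne).comp_hasFDerivAt x (hd.hasFDerivAt.add_const c)
  have hmain : HasFDerivAt (fun y => (h y + c)⁻¹ • fderiv ℝ h y) _ x :=
    hinv.smul hfd.hasFDerivAt
  rw [gprimec, D2, D2, hev.fderiv_eq, hmain.fderiv]
  simp
  field_simp
  ring

lemma gprime_eq_gprimec_zero {n : ℕ} (h : (Fin n → ℝ) → ℝ) : gprime h = gprimec h 0 := by
  funext x u v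
  simp [gprime, gprimec]

/-- Euler's identity for positively homogeneous functions. -/
lemma fderiv_self_of_homogeneous {n : ℕ} {h : (Fin n → ℝ) → ℝ} {x : Fin n → ℝ} {k : ℝ}
    (hd : DifferentiableAt ℝ h x) (hhom : ∀ l : ℝ, 0 < l → h (l • x) = l ^ k * h x) :
    fderiv ℝ h x x = k * h x := by
  have hline : HasDerivAt (fun l : ℝ => l • x) x 1 := by
    simpa using (hasDerivAt_id (1 : ℝ)).smul_const x
  have hleft : HasDerivAt (fun l : ℝ => h (l • x)) (fderiv ℝ h x x) 1 :=
    HasFDerivAt.comp_hasDerivAt_of_eq 1 hd.hasFDerivAt hline (by simp)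
  have hright : HasDerivAt (fun l : ℝ => l ^ k * h x) (k * h x) 1 := by
    simpa using (Real.hasDerivAt_rpow_const (x := 1) (p := k) (by simp)).mul_const (h x)
  refine hleft.unique (hright.congr_of_eventuallyEq ?_)
  filter_upwards [lt_mem_nhds one_pos] with l hl using hhom l hl

/-- Euler's identity for the derivative of a positively homogeneous function. -/
lemma D2_self_left_of_homogeneous {n : ℕ} {U : Set (Fin n → ℝ)} (hU : IsOpen U)
    (hcone : ∀ l : ℝ, 0 < l → ∀ x ∈ U, l • x ∈ U) {k : ℝ} {h : (Fin n → ℝ) → ℝ}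
    (hsm : ContDiffOn ℝ 2 h U) (hhom : ∀ l : ℝ, 0 < l → ∀ x ∈ U, h (l • x) = l ^ k * h x)
    {x : Fin n → ℝ} (hx : x ∈ U) (v : Fin n → ℝ) :
    D2 h x x v = (k - 1) * fderiv ℝ h x v := by
  have hcd : ∀ y ∈ U, ContDiffAt ℝ 2 h y := fun y hy => hsm.contDiffAt (hU.mem_nhds hy)
  have hdiff : ∀ y ∈ U, DifferentiableAt ℝ h y := fun y hy =>
    (hcd y hy).differentiableAt (by norm_num)
  have hscale : ∀ l : ℝ, 0 < l → l * fderiv ℝ h (l • x) v = l ^ k * fderiv ℝ h x v := by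
    intro l hl
    have hleft : HasFDerivAt (fun y => h (l • y))
        ((fderiv ℝ h (l • x)).comp (l • ContinuousLinearMap.id ℝ (Fin n → ℝ))) x :=
      (hdiff _ (hcone l hl x hx)).hasFDerivAt.comp x ((hasFDerivAt_id x).const_smul l)
    have hright : HasFDerivAt (fun y => h (l • y)) (l ^ k • fderiv ℝ h x) x := by
      refine ((hdiff x hx).hasFDerivAt.const_mul (l ^ k)).congr_of_eventuallyEq ?_
      filter_upwards [hU.mem_nhds hx] with y hy using hhom l hl y hy
    simpa using DFunLike.congr_fun (hleft.unique hright) v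
  have hline : HasDerivAt (fun l : ℝ => l • x) x 1 := by
    simpa using (hasDerivAt_id (1 : ℝ)).smul_const x
  have hfd : DifferentiableAt ℝ (fderiv ℝ h) x :=
    ((hcd x hx).fderiv_right (m := 1) (by norm_num)).differentiableAt (by norm_num)
  have hcomp : HasDerivAt (fun l : ℝ => fderiv ℝ h (l • x)) (fderiv ℝ (fderiv ℝ h) x x) 1 :=
    HasFDerivAt.comp_hasDerivAt_of_eq 1 hfd.hasFDerivAt hline (by simp)
  have hleft : HasDerivAt (fun l : ℝ => l * fderiv ℝ h (l • x) v)
      (fderiv ℝ h x v + D2 h x x v) 1 := by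
    have hmul := (hasDerivAt_id (1 : ℝ)).mul (hcomp.clm_apply (hasDerivAt_const 1 v))
    refine hmul.congr_deriv ?_
    simp [D2]
  have hright : HasDerivAt (fun l : ℝ => l ^ k * fderiv ℝ h x v) (k * fderiv ℝ h x v) 1 := by
    simpa using
      (Real.hasDerivAt_rpow_const (x := 1) (p := k) (by simp)).mul_const (fderiv ℝ h x v)
  have heq := hleft.unique (hright.congr_of_eventuallyEq
    (by filter_upwards [lt_mem_nhds one_pos] with l hl using hscale l hl))
  linarith

/-- Decomposing a vector into its radial part and its part in `ker Dh` shows that the second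
derivative of `h` is at most its radial part. -/
lemma D2_self_le_of_homogeneous {n : ℕ} {U : Set (Fin n → ℝ)} (hU : IsOpen U)
    (hcone : ∀ l : ℝ, 0 < l → ∀ x ∈ U, l • x ∈ U) {k : ℝ} (hk : 1 < k)
    {h : (Fin n → ℝ) → ℝ} (hsm : ContDiffOn ℝ 2 h U) (hpos : ∀ x ∈ U, 0 < h x)
    (hhom : ∀ l : ℝ, 0 < l → ∀ x ∈ U, h (l • x) = l ^ k * h x)
    (hker : ∀ x ∈ U, ∀ v : Fin n → ℝ, fderiv ℝ h x v = 0 → v ≠ 0 → 0 < gU h x v v)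
    {x : Fin n → ℝ} (hx : x ∈ U) (v : Fin n → ℝ) :
    k * h x * D2 h x v v ≤ (k - 1) * (fderiv ℝ h x v) ^ 2 := by
  have hcd : ContDiffAt ℝ 2 h x := hsm.contDiffAt (hU.mem_nhds hx)
  have hhx := hpos x hx
  have heuler := fderiv_self_of_homogeneous (hcd.differentiableAt (by norm_num))
    fun l hl => hhom l hl x hx
  have heuler₂ := D2_self_left_of_homogeneous hU hcone hsm hhom hx
  have hsymm : D2 h x v x = D2 h x x v :=
    (hcd.isSymmSndFDerivAt (by simp)).eq v x
  obtain ⟨a, ha⟩ : ∃ a, a = fderiv ℝ h x v / (k * h x) := ⟨_, rfl⟩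
  have hDv : fderiv ℝ h x v = a * (k * h x) := by
    rw [ha]; field_simp
  have hw : fderiv ℝ h x (v - a • x) = 0 := by
    simp [heuler, hDv]
  have hnonneg : 0 ≤ gU h x (v - a • x) (v - a • x) := by
    rcases eq_or_ne (v - a • x) 0 with h0 | h0
    · simp [h0, gU, D2]
    · exact (hker x hx _ hw h0).le
  have hexpand : D2 h x (v - a • x) (v - a • x) =
      D2 h x v v - a * D2 h x v x - a * D2 h x x v + a ^ 2 * D2 h x x x := by
    simp [D2]; ring
  rw [gU, hexpand, hsymm, heuler₂ v, heuler₂ x, heuler, hDv] at hnonneg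
  have hkh : 0 < k * h x := by positivity
  rw [hDv]
  nlinarith [mul_nonneg hkh.le hnonneg]

/-- Pointwise comparison of the two metrics: here `q` is `D²h(v, v)`, `p` is `Dh(v)`, and `r`, `s`
are the values of `h` and `h + c`. -/
lemma shifted_metric_bounds {k r s q p : ℝ} (hk : 1 < k) (hs : 0 < s) (hsr : s ≤ r)
    (hq : k * r * q ≤ (k - 1) * p ^ 2) :
    -q / r + p ^ 2 / r ^ 2 ≤ -q / s + p ^ 2 / s ^ 2 ∧
      p ^ 2 / s ^ 2 ≤ k * (-q / s + p ^ 2 / s ^ 2) := by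
  have hr : 0 < r := hs.trans_le hsr
  have hsecond : k * q * s ≤ (k - 1) * p ^ 2 := by
    rcases le_total q 0 with hq0 | hq0
    · have : k * q * s ≤ 0 := by
        have := mul_nonneg (mul_nonneg (by linarith : (0:ℝ) ≤ k) (neg_nonneg.2 hq0)) hs.le
        linarith
      nlinarith [mul_nonneg (by linarith : (0:ℝ) ≤ k - 1) (sq_nonneg p)]
    · have := mul_le_mul_of_nonneg_left hsr (mul_nonneg (by linarith : (0:ℝ) ≤ k) hq0)
      linarith
  constructor
  · have hdiff : -q / s + p ^ 2 / s ^ 2 - (-q / r + p ^ 2 / r ^ 2) =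
        (r - s) * (r * (p ^ 2 - q * s) + s * p ^ 2) / (r ^ 2 * s ^ 2) := by
      field_simp; ring
    have hqs : q * s ≤ p ^ 2 := by
      have h1 : k * (q * s) ≤ k * p ^ 2 := by nlinarith [sq_nonneg p]
      exact le_of_mul_le_mul_left h1 (by linarith)
    have hnum : 0 ≤ (r - s) * (r * (p ^ 2 - q * s) + s * p ^ 2) :=
      mul_nonneg (by linarith) (add_nonneg (mul_nonneg hr.le (by linarith)) (by positivity))
    have : 0 ≤ -q / s + p ^ 2 / s ^ 2 - (-q / r + p ^ 2 / r ^ 2) := by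
      rw [hdiff]; positivity
    linarith
  · have : k * (-q / s + p ^ 2 / s ^ 2) - p ^ 2 / s ^ 2 =
        ((k - 1) * p ^ 2 - k * q * s) / s ^ 2 := by
      field_simp; ring
    have h2 : 0 ≤ ((k - 1) * p ^ 2 - k * q * s) / s ^ 2 := div_nonneg (by linarith) (by positivity)
    linarith

lemma measurableSet_Ival (T : ℝ≥0∞) : MeasurableSet (Ival T) :=
  measurableSet_Ici.inter (measurableSet_lt ENNReal.measurable_ofReal measurable_const)

lemma Icc_subset_Ival {T : ℝ≥0∞} {t : ℝ} (ht : t ∈ Ival T) : Set.Icc 0 t ⊆ Ival T :=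
  fun _ hs => ⟨hs.1, (ENNReal.ofReal_le_ofReal hs.2).trans_lt ht.2⟩

/-- Every positive parameter in `Ival T` is an interior point. -/
lemma Ival_mem_nhds {T : ℝ≥0∞} {t : ℝ} (ht : t ∈ Ival T) (h0 : t ≠ 0) : Ival T ∈ nhds t := by
  have hlt := ENNReal.continuous_ofReal.continuousAt.eventually (gt_mem_nhds ht.2)
  filter_upwards [lt_mem_nhds (ht.1.lt_of_ne' h0), hlt] with s hs hsT using ⟨hs.le, hsT⟩

/-- Let `h` be smooth, positive and positively homogeneous of degree `k > 1` on an
open cone `U ⊆ ℝⁿ`, with `−D²h` positive definite on `ker Dh`.  If the metric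
`g' = −D²(log h)` is complete on `U` (every C¹ curve leaving every compact subset has
infinite length), then for every `c < 0` the metric `g'_c = −D²(log(h+c))` is
complete on `U_c = {x ∈ U : h(x) + c > 0}` in the same sense. -/
theorem stmt18 {n : ℕ} (hn : 1 ≤ n)
    (U : Set (Fin n → ℝ)) (hU : IsOpen U)
    (hcone : ∀ l : ℝ, 0 < l → ∀ x ∈ U, l • x ∈ U)
    (k : ℝ) (hk : 1 < k)
    (h : (Fin n → ℝ) → ℝ) (hsm : ContDiffOn ℝ (⊤ : ℕ∞) h U)
    (hpos : ∀ x ∈ U, 0 < h x)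
    (hhom : ∀ l : ℝ, 0 < l → ∀ x ∈ U, h (l • x) = l ^ k * h x)
    (hker : ∀ x ∈ U, ∀ v : Fin n → ℝ, fderiv ℝ h x v = 0 → v ≠ 0 → 0 < gU h x v v)
    (hcomplete : IsCompleteMetricOn (gprime h) U) :
    ∀ c < (0 : ℝ), IsCompleteMetricOn (gprimec h c) {x ∈ U | 0 < h x + c} := by
  intro c hc T hT γ hγ hmaps hnot
  by_contra hfin
  have hsm₂ : ContDiffOn ℝ 2 h U := hsm.of_le (WithTop.coe_le_coe.2 (le_top : (2 : ℕ∞) ≤ ⊤))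
  have hmapsU : Set.MapsTo γ (Ival T) U := fun t ht => (hmaps ht).1
  have hcd : ∀ x ∈ U, ContDiffAt ℝ 2 h x := fun x hx => hsm₂.contDiffAt (hU.mem_nhds hx)
  have hbounds : ∀ t ∈ Ival T, ∀ v,
      gprime h (γ t) v v ≤ gprimec h c (γ t) v v ∧
        (fderiv ℝ h (γ t) v / (h (γ t) + c)) ^ 2 ≤ k * gprimec h c (γ t) v v := by
    intro t ht v
    have hx := hmapsU ht
    rw [gprime_eq_gprimec_zero, gprimec_apply_self (hcd _ hx) (hmaps ht).2,
      gprimec_apply_self (hcd _ hx) (by simpa using hpos _ hx), add_zero, div_pow]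
    exact shifted_metric_bounds hk (hmaps ht).2 (by linarith)
      (D2_self_le_of_homogeneous hU hcone hk hsm₂ hpos hhom hker hx v)
  obtain ⟨K, hK, hKU, hγK⟩ : ∃ K, IsCompact K ∧ K ⊆ U ∧ γ '' Ival T ⊆ K := by
    by_contra hK
    refine hfin (top_le_iff.1 ?_)
    rw [← hcomplete T hT γ hγ hmapsU hK]
    refine setLIntegral_mono' (measurableSet_Ival T) fun t ht => ?_
    exact ENNReal.ofReal_le_ofReal (Real.sqrt_le_sqrt (hbounds t ht _).1)
  set L := ∫⁻ t in Ival T,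
    ENNReal.ofReal (Real.sqrt (gprimec h c (γ t) (deriv γ t) (deriv γ t))) with hL
  set F : ℝ → ℝ := fun t => Real.log (h (γ t) + c)
  have hFcd : ContDiffOn ℝ 1 F (Ival T) :=
    (((hsm₂.of_le (by norm_num)).comp hγ hmapsU).add contDiffOn_const).log
      fun t ht => (hmaps ht).2.ne'
  have hFbound : ∀ t ∈ Ival T, ‖F t - F 0‖ₑ ≤ ENNReal.ofReal (Real.sqrt k) * L := by
    intro t ht
    refine (enorm_sub_le_lintegral_deriv_of_contDiffOn_Icc
      (hFcd.mono (Icc_subset_Ival ht)) ht.1).trans ?_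
    rw [hL, ← lintegral_const_mul' _ _ ENNReal.ofReal_ne_top]
    refine (lintegral_mono_set (Icc_subset_Ival ht)).trans (lintegral_mono_ae ?_)
    filter_upwards [ae_restrict_mem (measurableSet_Ival T),
      ae_restrict_of_ae (Measure.ae_ne volume (0 : ℝ))] with s hs hs0
    have hγs : HasDerivAt γ (deriv γ s) s :=
      ((hγ.contDiffAt (Ival_mem_nhds hs hs0)).differentiableAt (by norm_num)).hasDerivAt
    have hhs := ((hcd _ (hmapsU hs)).differentiableAt (by norm_num)).hasFDerivAt
    have hFs : deriv F s = fderiv ℝ h (γ s) (deriv γ s) / (h (γ s) + c) :=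
      (((hhs.comp_hasDerivAt s hγs).add_const c).log (hmaps hs).2.ne').deriv
    rw [hFs, ← ENNReal.ofReal_mul (Real.sqrt_nonneg k), ← Real.sqrt_mul (by linarith),
      ← ofReal_norm, Real.norm_eq_abs]
    exact ENNReal.ofReal_le_ofReal (Real.abs_le_sqrt (hbounds s hs _).2)
  have hMtop : ENNReal.ofReal (Real.sqrt k) * L ≠ ⊤ := ENNReal.mul_ne_top ENNReal.ofReal_ne_top hfin
  set M := (ENNReal.ofReal (Real.sqrt k) * L).toReal
  refine hnot ⟨K ∩ h ⁻¹' Set.Ici (Real.exp (F 0 - M) - c), ?_, ?_, ?_⟩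
  · exact hK.of_isClosed_subset ((hsm₂.continuousOn.mono hKU).preimage_isClosed_of_isClosed
      hK.isClosed isClosed_Ici) Set.inter_subset_left
  · rintro x ⟨hxK, hx⟩
    have hx' : Real.exp (F 0 - M) - c ≤ h x := hx
    exact ⟨hKU hxK, by linarith [Real.exp_pos (F 0 - M)]⟩
  · rintro _ ⟨t, ht, rfl⟩
    refine ⟨hγK ⟨t, ht, rfl⟩, ?_⟩
    have hnorm : |F t - F 0| ≤ M := by
      have := ENNReal.toReal_mono hMtop (hFbound t ht)
      rwa [toReal_enorm, Real.norm_eq_abs] at this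
    have hle : Real.exp (F 0 - M) ≤ h (γ t) + c := by
      rw [← Real.le_log_iff_exp_le (hmaps ht).2]
      linarith [(abs_le.1 hnorm).1]
    show Real.exp (F 0 - M) - c ≤ h (γ t)
    linarith
end
end
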